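/- arXiv:2402.17865 — 2 statements merged into one kernel-verified Lean document; each statement's English description precedes it below -/
import Mathlib

section
/- Suppose a_1, …, a_p are nonzero and pairwise distinct. Then every ℂ-linear subspace W ⊆ R_a(λ) that is invariant under multiplication by the image of each variable t_i (1 ≤ i ≤ d) and invariant under the ℂ-linear action of every permutation σ ∈ S_d (induced by permuting the variables t_1, …, t_d) satisfies W = 0 or W = R_a(λ). -/
open MvPolynomial

noncomputable section

/-- Complete homogeneous symmetric function `h_k` of a list of complex numbers. -/
def hcomp : ℕ → List ℂ → ℂ
  | 0, _ => 1
  | _ + 1, [] => 0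
  | k + 1, x :: l => x * hcomp k (x :: l) + hcomp (k + 1) l
  termination_by k l => (l.length, k)

/-- Elementary symmetric polynomial `e_r` in the variables indexed by `J ⊆ {1,…,d}`. -/
def elemSym (d : ℕ) (J : Finset (Fin d)) (r : ℕ) : MvPolynomial (Fin d) ℂ :=
  ∑ s ∈ J.powersetCard r, ∏ j ∈ s, X j

/-- The tuple `a^{(n)}` : entries `a_1,…,a_{λ_i}` for each row `i = n+1,…,ℓ` (0-indexed rows). -/
def aTuple (ℓ : ℕ) (lam : ℕ → ℕ) (a : ℕ → ℂ) (n : ℕ) : List ℂ :=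
  ((List.range ℓ).drop n).flatMap fun i => (List.range (lam i)).map a

/-- `m_λ(n) = λ_{n+1} + … + λ_ℓ` (0-indexed rows `n,…,ℓ-1`). -/
def mRem (ℓ : ℕ) (lam : ℕ → ℕ) (n : ℕ) : ℕ := ∑ i ∈ Finset.Ico n ℓ, lam i

/-- The deformed Tanisaki generator `g_{n,J,r} = Σ_{k=0}^r (−1)^k e_{r−k}(t_J) h_k(a^{(n)})`. -/
def tanGen (d ℓ : ℕ) (lam : ℕ → ℕ) (a : ℕ → ℂ) (n : ℕ) (J : Finset (Fin d)) (r : ℕ) :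
    MvPolynomial (Fin d) ℂ :=
  ∑ k ∈ Finset.range (r + 1), C ((-1) ^ k * hcomp k (aTuple ℓ lam a n)) * elemSym d J (r - k)

/-- The deformed Tanisaki ideal `⟨𝒞^a_λ⟩`. -/
def tanIdeal (d ℓ : ℕ) (lam : ℕ → ℕ) (a : ℕ → ℂ) : Ideal (MvPolynomial (Fin d) ℂ) :=
  Ideal.span {g | ∃ n J r, n < ℓ ∧ J.card = d - n ∧
    d - n - mRem ℓ lam n < r ∧ r ≤ d - n ∧ g = tanGen d ℓ lam a n J r}

/-- `lam 0, lam 1, …, lam (ℓ-1)` is a partition of `d` with `ℓ` positive parts. -/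
def IsPartitionOf (d ℓ : ℕ) (lam : ℕ → ℕ) : Prop :=
  0 < ℓ ∧ (∀ i j, i ≤ j → lam j ≤ lam i) ∧ (∀ i < ℓ, 0 < lam i) ∧
    (∀ i, ℓ ≤ i → lam i = 0) ∧ ∑ i ∈ Finset.range ℓ, lam i = d

/-- `λ^t_i = #{rows j with λ_j ≥ i}` (here `i ≥ 1`). -/
def lamT (ℓ : ℕ) (lam : ℕ → ℕ) (i : ℕ) : ℕ :=
  ((Finset.range ℓ).filter fun j => i ≤ lam j).card

/-- The deformed Tanisaki–Garsia–Procesi algebra `R_a(λ)`. -/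
abbrev TGPAlg (d ℓ : ℕ) (lam : ℕ → ℕ) (a : ℕ → ℂ) :=
  MvPolynomial (Fin d) ℂ ⧸ tanIdeal d ℓ lam a


def Qp (b : List ℂ) : Polynomial ℂ := (b.map fun x => 1 + Polynomial.C x * Polynomial.X).prod

def Hs (b : List ℂ) : PowerSeries ℂ := PowerSeries.mk fun k => (-1) ^ k * hcomp k b

lemma Qp_mul_Hs (b : List ℂ) : (Qp b : PowerSeries ℂ) * Hs b = 1 := by
  induction b with
  | nil =>
    ext k
    cases k <;> simp [Qp, Hs, hcomp]
  | cons x l ih =>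
    have h1 : (1 + PowerSeries.C x * PowerSeries.X) * Hs (x :: l) = Hs l := by
      ext k
      cases k with
      | zero => simp [Hs, hcomp]
      | succ k =>
        rw [add_mul, one_mul, mul_assoc, map_add, PowerSeries.coeff_C_mul,
          PowerSeries.coeff_succ_X_mul]
        simp only [Hs, PowerSeries.coeff_mk]
        conv_lhs => rw [hcomp]
        ring
    have h2 : (Qp (x :: l) : PowerSeries ℂ)
        = (Qp l : PowerSeries ℂ) * (1 + PowerSeries.C x * PowerSeries.X) := by
      rw [mul_comm]; simp [Qp]
    rw [h2, mul_assoc, h1, ih]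

lemma Qp_natDegree (b : List ℂ) : (Qp b).natDegree ≤ b.length := by
  induction b with
  | nil => simp [Qp]
  | cons x l ih =>
    have : Qp (x :: l) = (1 + Polynomial.C x * Polynomial.X) * Qp l := by simp [Qp]
    rw [this]
    refine Polynomial.natDegree_mul_le.trans ?_
    have : (1 + Polynomial.C x * Polynomial.X : Polynomial ℂ).natDegree ≤ 1 := by
      compute_degree
    simp only [List.length_cons]; omega

lemma Qp_eval (b : List ℂ) (x : ℂ) (hx : x ≠ 0) (hb : x ∈ b) : (Qp b).eval (-x⁻¹) = 0 := by
  rw [Qp, Polynomial.eval_list_prod]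
  apply List.prod_eq_zero
  simp only [List.map_map, List.mem_map]
  exact ⟨x, hb, by simp [hx]⟩

lemma prod_coeff {ι A : Type*} [CommRing A] (t : ι → A) (J : Finset ι) (r : ℕ) :
    (∏ j ∈ J, (1 + Polynomial.C (t j) * Polynomial.X)).coeff r
      = ∑ s ∈ J.powersetCard r, ∏ j ∈ s, t j := by
  classical
  rw [Finset.prod_one_add, Polynomial.finsetSum_coeff, Finset.powersetCard_eq_filter,
    Finset.sum_filter]
  refine Finset.sum_congr rfl fun s _ => ?_
  rw [Finset.prod_mul_distrib, Finset.prod_const, ← map_prod, Polynomial.coeff_C_mul,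
    Polynomial.coeff_X_pow]
  simp [eq_comm]

lemma prod_natDegree {ι A : Type*} [CommRing A] (t : ι → A) (J : Finset ι) :
    (∏ j ∈ J, (1 + Polynomial.C (t j) * Polynomial.X)).natDegree ≤ J.card := by
  rw [Polynomial.natDegree_le_iff_coeff_eq_zero]
  intro r hr
  rw [prod_coeff, Finset.powersetCard_eq_empty.2 hr, Finset.sum_empty]

lemma key {d ℓ : ℕ} {lam : ℕ → ℕ} {a : ℕ → ℂ} {A : Type*} [CommRing A] [Algebra ℂ A]
    (φ : MvPolynomial (Fin d) ℂ →ₐ[ℂ] A) (hφ : ∀ f ∈ tanIdeal d ℓ lam a, φ f = 0)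
    (n : ℕ) (hn : n < ℓ) (J : Finset (Fin d)) (hJ : J.card = d - n)
    (hm : mRem ℓ lam n ≤ d - n) (hlen : (aTuple ℓ lam a n).length = mRem ℓ lam n) :
    ∃ T : Polynomial A, T.natDegree ≤ d - n - mRem ℓ lam n ∧
      ∏ j ∈ J, (1 + Polynomial.C (φ (X j)) * Polynomial.X)
        = (Qp (aTuple ℓ lam a n)).map (algebraMap ℂ A) * T := by
  set b := aTuple ℓ lam a n with hb
  set m := mRem ℓ lam n with hmdef
  set P : Polynomial A := ∏ j ∈ J, (1 + Polynomial.C (φ (X j)) * Polynomial.X) with hP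
  set Q : Polynomial A := (Qp b).map (algebraMap ℂ A) with hQ
  set G : PowerSeries A := PowerSeries.map (algebraMap ℂ A) (Hs b) * (P : PowerSeries A) with hG
  have hQG : (P : PowerSeries A) = (Q : PowerSeries A) * G := by
    rw [hG, ← mul_assoc, hQ, Polynomial.polynomial_map_coe, ← map_mul, Qp_mul_Hs, map_one, one_mul]
  have hGc : ∀ r, PowerSeries.coeff r G = φ (tanGen d ℓ lam a n J r) := by
    intro r
    rw [hG, PowerSeries.coeff_mul, Finset.Nat.sum_antidiagonal_eq_sum_range_succ_mk, tanGen, map_sum]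
    refine Finset.sum_congr rfl fun k _ => ?_
    rw [map_mul, ← MvPolynomial.algebraMap_eq, AlgHom.commutes, Polynomial.coeff_coe, hP, prod_coeff]
    simp [Hs, elemSym, hb]
  have hG0 : ∀ r, d - n - m < r → r ≤ d - n → PowerSeries.coeff r G = 0 := by
    intro r h1 h2
    rw [hGc]
    exact hφ _ (Ideal.subset_span ⟨n, J, r, hn, hJ, h1, h2, rfl⟩)
  have hTd : (PowerSeries.trunc (d - n - m + 1) G).natDegree ≤ d - n - m :=
    Nat.lt_succ_iff.1 (PowerSeries.natDegree_trunc_lt _ _)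
  refine ⟨PowerSeries.trunc (d - n - m + 1) G, hTd, ?_⟩
  ext r
  by_cases hr : r ≤ d - n
  · rw [← Polynomial.coeff_coe, hQG, PowerSeries.coeff_mul, Polynomial.coeff_mul]
    refine Finset.sum_congr rfl fun x hx => ?_
    have hx2 : x.2 ≤ d - n := by
      have := Finset.HasAntidiagonal.mem_antidiagonal.1 hx; omega
    rw [Polynomial.coeff_coe, PowerSeries.coeff_trunc]
    split_ifs with h
    · rfl
    · rw [hG0 _ (by omega) hx2]
  · rw [Polynomial.coeff_eq_zero_of_natDegree_lt, Polynomial.coeff_eq_zero_of_natDegree_lt]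
    · refine lt_of_le_of_lt Polynomial.natDegree_mul_le ?_
      have h1 : Q.natDegree ≤ m := by
        rw [← hlen]
        exact Polynomial.natDegree_map_le.trans (Qp_natDegree b)
      omega
    · have := prod_natDegree (fun j => φ (X j)) J
      rw [← hP] at this
      omega

lemma multiset_eq (s t : Multiset ℂ) (hc : s.card = t.card)
    (h : (s.map fun x => 1 + Polynomial.C x * Polynomial.X).prod
      = (t.map fun x => 1 + Polynomial.C x * Polynomial.X).prod) : s = t := by
  have ev : ∀ (u : Multiset ℂ) (y : ℂ), y ≠ 0 →
      (u.map fun x => Polynomial.X - Polynomial.C x).prod.eval y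
        = y ^ u.card * ((u.map fun x => 1 + Polynomial.C x * Polynomial.X).prod).eval (-y⁻¹) := by
    intro u y hy
    induction u using Multiset.induction_on with
    | empty => simp
    | cons x u ih =>
      simp only [Multiset.map_cons, Multiset.prod_cons, Polynomial.eval_mul, ih,
        Multiset.card_cons]
      have hxy : y - x = y * (1 + x * (-y⁻¹)) := by
        field_simp
        ring
      simp only [Polynomial.eval_sub, Polynomial.eval_X, Polynomial.eval_C, Polynomial.eval_add,
        Polynomial.eval_one, Polynomial.eval_mul]
      rw [hxy]; ring
  have h2 : (s.map fun x => Polynomial.X - Polynomial.C x).prod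
      = (t.map fun x => Polynomial.X - Polynomial.C x).prod := by
    apply Polynomial.eq_of_infinite_eval_eq
    refine Set.Infinite.mono (s := {0}ᶜ) ?_ (Set.finite_singleton (0 : ℂ)).infinite_compl
    intro y hy
    simp only [Set.mem_setOf_eq]
    rw [ev s y hy, ev t y hy, h, hc]
  rw [← Polynomial.roots_multiset_prod_X_sub_C s, h2, Polynomial.roots_multiset_prod_X_sub_C]

lemma aTuple_length (ℓ : ℕ) (lam : ℕ → ℕ) (a : ℕ → ℂ) (n : ℕ) :
    (aTuple ℓ lam a n).length = mRem ℓ lam n := by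
  have : (List.range ℓ).drop n = List.range' n (ℓ - n) := by
    rw [List.range_eq_range', List.drop_range']; simp
  rw [aTuple, this, List.length_flatMap, mRem]
  simp [Finset.sum, Finset.Ico, Multiset.Ico, LocallyFiniteOrder.finsetIco]

lemma aTuple_mem {ℓ : ℕ} {lam : ℕ → ℕ} {a : ℕ → ℂ} {n i k : ℕ} (h1 : n ≤ i) (h2 : i < ℓ)
    (h3 : k < lam i) : a k ∈ aTuple ℓ lam a n := by
  have : (List.range ℓ).drop n = List.range' n (ℓ - n) := by
    rw [List.range_eq_range', List.drop_range']; simp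
  rw [aTuple, this, List.mem_flatMap]
  refine ⟨i, by rw [List.mem_range'_1]; omega, ?_⟩
  exact List.mem_map.2 ⟨k, List.mem_range.2 h3, rfl⟩

lemma aTuple_mem_inv {ℓ : ℕ} {lam : ℕ → ℕ} {a : ℕ → ℂ} {x : ℂ}
    (h : x ∈ aTuple ℓ lam a 0) : ∃ i k, i < ℓ ∧ k < lam i ∧ x = a k := by
  rw [aTuple, List.mem_flatMap] at h
  obtain ⟨i, hi, hx⟩ := h
  obtain ⟨k, hk, rfl⟩ := List.mem_map.1 hx
  exact ⟨i, k, by simpa using hi, by simpa using hk, rfl⟩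

lemma aTuple_count {ℓ : ℕ} {lam : ℕ → ℕ} {a : ℕ → ℂ} (hmono : ∀ i, lam i ≤ lam 0)
    (hdist : ∀ i j, i < lam 0 → j < lam 0 → i ≠ j → a i ≠ a j) (k : ℕ) (hk : k < lam 0) :
    (aTuple ℓ lam a 0).count (a k) = ((Finset.range ℓ).filter fun i => k < lam i).card := by
  have hrow : ∀ i, ((List.range (lam i)).map a).count (a k) = if k < lam i then 1 else 0 := by
    intro i
    have hnd : ((List.range (lam i)).map a).Nodup := by
      refine List.Nodup.map_on ?_ List.nodup_range
      intro x hx y hy hxy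
      by_contra hne
      rw [List.mem_range] at hx hy
      exact hdist x y (hx.trans_le (hmono i)) (hy.trans_le (hmono i)) hne hxy
    rw [hnd.count]
    refine if_congr ?_ rfl rfl
    rw [List.mem_map]
    constructor
    · rintro ⟨x, hx, hxk⟩
      rw [List.mem_range] at hx
      by_contra hlt
      refine hdist x k (hx.trans_le (hmono i)) hk ?_ hxk
      omega
    · intro h
      exact ⟨k, List.mem_range.2 h, rfl⟩
  rw [aTuple, List.drop_zero, List.count_flatMap, Finset.card_filter]
  have : (List.count (a k) ∘ fun i => (List.range (lam i)).map a)
      = fun i => if k < lam i then 1 else 0 := by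
    funext i; exact hrow i
  rw [this]
  simp [Finset.sum, Finset.range, Multiset.range]

lemma rename_tanGen (d ℓ : ℕ) (lam : ℕ → ℕ) (a : ℕ → ℂ) (n : ℕ) (J : Finset (Fin d)) (r : ℕ)
    (σ : Equiv.Perm (Fin d)) :
    rename σ (tanGen d ℓ lam a n J r) = tanGen d ℓ lam a n (J.map σ.toEmbedding) r := by
  simp only [tanGen, map_sum, map_mul, rename_C]
  refine Finset.sum_congr rfl fun k _ => ?_
  congr 1
  rw [elemSym, elemSym, Finset.powersetCard_map, Finset.sum_map]
  simp [map_prod, Finset.mapEmbedding_apply]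

lemma rename_mem {d ℓ : ℕ} {lam : ℕ → ℕ} {a : ℕ → ℂ} (σ : Equiv.Perm (Fin d))
    (f : MvPolynomial (Fin d) ℂ) (hf : f ∈ tanIdeal d ℓ lam a) :
    rename σ f ∈ tanIdeal d ℓ lam a := by
  have : tanIdeal d ℓ lam a
      ≤ (tanIdeal d ℓ lam a).comap (rename σ : MvPolynomial (Fin d) ℂ →ₐ[ℂ] _) := by
    conv_lhs => rw [tanIdeal]
    rw [Ideal.span_le]
    rintro g ⟨n, J, r, hn, hJ, h1, h2, rfl⟩
    change rename σ _ ∈ tanIdeal d ℓ lam a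
    rw [rename_tanGen]
    exact Ideal.subset_span ⟨n, _, r, hn, by simpa using hJ, h1, h2, rfl⟩
  exact this hf

/-- Points of the zero locus have the prescribed content. -/
lemma point_content {d ℓ : ℕ} {lam : ℕ → ℕ} (hpart : IsPartitionOf d ℓ lam) {a : ℕ → ℂ}
    (c : Fin d → ℂ) (hc : ∀ f ∈ tanIdeal d ℓ lam a, aeval c f = 0) :
    (Finset.univ.val.map c : Multiset ℂ) = (aTuple ℓ lam a 0 : Multiset ℂ) := by
  have hm0 : mRem ℓ lam 0 = d := by
    rw [mRem, ← hpart.2.2.2.2, Finset.range_eq_Ico]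
  have hlen := aTuple_length ℓ lam a 0
  obtain ⟨T, hT, hPT⟩ := key (aeval c) hc 0 hpart.1 Finset.univ (by simp) (by omega) hlen
  rw [hm0] at hT
  have hT0 : T = Polynomial.C (T.coeff 0) := Polynomial.eq_C_of_natDegree_le_zero (by omega)
  have hT1 : T.coeff 0 = 1 := by
    have := congrArg (Polynomial.eval 0) hPT
    rw [hT0] at this
    simp [Polynomial.eval_prod, Qp, Polynomial.eval_list_prod, Function.comp_def] at this
    exact this.symm
  rw [hT0, hT1] at hPT
  apply multiset_eq
  · simp [hlen, hm0]
  · simp only [aeval_X, Polynomial.map_id, Algebra.algebraMap_self, map_one, mul_one] at hPT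
    rw [Multiset.map_map]
    simp only [Multiset.map_coe, Multiset.prod_coe]
    exact hPT

lemma local_unit {d ℓ : ℕ} {lam : ℕ → ℕ} (hpart : IsPartitionOf d ℓ lam) {a : ℕ → ℂ}
    (ha0 : ∀ i, i < lam 0 → a i ≠ 0)
    (hdist : ∀ i j, i < lam 0 → j < lam 0 → i ≠ j → a i ≠ a j)
    (c : Fin d → ℂ) (hc : ∀ f ∈ tanIdeal d ℓ lam a, aeval c f = 0) (j : Fin d) :
    ∃ u : MvPolynomial (Fin d) ℂ, aeval c u ≠ 0 ∧ u * (X j - C (c j)) ∈ tanIdeal d ℓ lam a := by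
  classical
  obtain ⟨hℓ, hmono, hpos, hzero, hsum⟩ := id hpart
  have hcont := point_content hpart c hc
  have hcj : c j ∈ aTuple ℓ lam a 0 := by
    rw [← Multiset.mem_coe, ← hcont]
    exact Multiset.mem_map_of_mem c (Finset.mem_univ j)
  obtain ⟨i0, k, hi0, hk, hck⟩ := aTuple_mem_inv hcj
  have hk0 : k < lam 0 := hk.trans_le (hmono 0 i0 (Nat.zero_le _))
  have hx : c j ≠ 0 := hck ▸ ha0 k hk0
  set μ := ((Finset.range ℓ).filter fun i => k < lam i).card with hμ
  have hcount : (Finset.univ.filter fun i => c i = c j).card = μ := by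
    rw [hμ, ← aTuple_count (fun i => hmono 0 i (Nat.zero_le _)) hdist k hk0,
      ← Multiset.coe_count, ← hcont, Multiset.count_map, ← hck, Finset.card_def,
      Finset.filter_val]
    simp only [eq_comm]
  have hμ1 : 0 < μ := by
    rw [← hcount]; exact Finset.card_pos.2 ⟨j, by simp⟩
  have hμℓ : μ ≤ ℓ := by
    rw [hμ]; exact (Finset.card_filter_le _ _).trans (by simp)
  have hrow : k < lam (μ - 1) := by
    by_contra hlt
    have : ((Finset.range ℓ).filter fun i => k < lam i) ⊆ Finset.range (μ - 1) := by
      intro i hi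
      rw [Finset.mem_filter] at hi
      rw [Finset.mem_range]
      by_contra h
      have := hmono (μ - 1) i (by omega)
      omega
    have := Finset.card_le_card this
    rw [← hμ, Finset.card_range] at this
    omega
  have hmem : c j ∈ aTuple ℓ lam a (μ - 1) := by
    rw [hck]; exact aTuple_mem le_rfl (by omega) hrow
  have hm : mRem ℓ lam (μ - 1) ≤ d - (μ - 1) := by
    have h1 : mRem ℓ lam (μ - 1) + ∑ i ∈ Finset.range (μ - 1), lam i = d := by
      rw [mRem, ← hsum, add_comm]
      exact Finset.sum_range_add_sum_Ico _ (by omega)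
    have h2 : μ - 1 ≤ ∑ i ∈ Finset.range (μ - 1), lam i := by
      calc μ - 1 = ∑ i ∈ Finset.range (μ - 1), 1 := by simp
        _ ≤ _ := Finset.sum_le_sum fun i hi => hpos i (by
          rw [Finset.mem_range] at hi; omega)
    omega
  set K : Finset (Fin d) := Finset.univ.filter fun i => ¬ c i = c j with hK
  have hjK : j ∉ K := by simp [hK]
  have hJ : (insert j K).card = d - (μ - 1) := by
    rw [Finset.card_insert_of_notMem hjK]
    have := Finset.card_filter_add_card_filter_not (s := (Finset.univ : Finset (Fin d)))
      (fun i => c i = c j)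
    rw [hcount, Finset.card_univ, Fintype.card_fin] at this
    change μ + K.card = d at this
    omega
  obtain ⟨T, -, hT⟩ := key (Ideal.Quotient.mkₐ ℂ (tanIdeal d ℓ lam a))
    (fun f hf => Ideal.Quotient.eq_zero_iff_mem.2 hf) (μ - 1) (by omega) (insert j K) hJ hm
    (aTuple_length _ _ _ _)
  have hev := congrArg (Polynomial.eval (algebraMap ℂ _ (-(c j)⁻¹))) hT
  rw [Polynomial.eval_mul, Polynomial.eval_map_algebraMap, Polynomial.aeval_algebraMap_apply,
    Polynomial.coe_aeval_eq_eval, Qp_eval _ _ hx hmem, map_zero, zero_mul,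
    Finset.prod_insert hjK, Polynomial.eval_mul, Polynomial.eval_prod] at hev
  refine ⟨∏ i ∈ K, (1 - C (c j)⁻¹ * X i), ?_, ?_⟩
  · rw [map_prod, Finset.prod_ne_zero_iff]
    intro i hi
    have hi' : c i ≠ c j := by simpa [hK] using hi
    simp only [map_sub, map_one, map_mul, aeval_X, ← MvPolynomial.algebraMap_eq, AlgHom.commutes,
      Algebra.algebraMap_self, RingHom.id_apply]
    intro h
    apply hi'
    field_simp at h
    linear_combination -h
  · rw [← Ideal.Quotient.eq_zero_iff_mem]
    have e : (X j - C (c j) : MvPolynomial (Fin d) ℂ)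
        = -C (c j) * (1 - C (c j)⁻¹ * X j) := by
      have : (C (c j) * C (c j)⁻¹ : MvPolynomial (Fin d) ℂ) = 1 := by
        rw [← C_mul, mul_inv_cancel₀ hx, C_1]
      linear_combination (- X j) * this
    have e2 : ∀ i, Polynomial.eval (algebraMap ℂ (TGPAlg d ℓ lam a) (-(c j)⁻¹))
        (1 + Polynomial.C (Ideal.Quotient.mkₐ ℂ (tanIdeal d ℓ lam a) (X i)) * Polynomial.X)
        = Ideal.Quotient.mk (tanIdeal d ℓ lam a) (1 - C (c j)⁻¹ * X i) := by
      intro i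
      have : algebraMap ℂ (TGPAlg d ℓ lam a) (-(c j)⁻¹)
        = Ideal.Quotient.mk (tanIdeal d ℓ lam a) (C (-(c j)⁻¹)) := rfl
      rw [this]
      simp only [Polynomial.eval_add, Polynomial.eval_one, Polynomial.eval_mul, Polynomial.eval_C,
        Polynomial.eval_X, map_sub, map_one, map_mul, map_neg, Ideal.Quotient.mkₐ_eq_mk]
      ring
    simp only [e2] at hev
    rw [e, map_mul, map_mul, map_prod]
    linear_combination (Ideal.Quotient.mk (tanIdeal d ℓ lam a) (-C (c j))) * hev

/-- A proper ideal has a zero. -/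
lemma exists_zero {d : ℕ} (I : Ideal (MvPolynomial (Fin d) ℂ)) (hI : I ≠ ⊤) :
    ∃ c : Fin d → ℂ, ∀ f ∈ I, aeval c f = 0 := by
  obtain ⟨M, hM, hIM⟩ := Ideal.exists_le_maximal I hI
  obtain ⟨c, rfl⟩ := (MvPolynomial.isMaximal_iff_eq_vanishingIdeal_singleton (K := ℂ)).1 hM
  exact ⟨c, fun f hf => hIM hf c rfl⟩

lemma mem_of_vanish {d ℓ : ℕ} {lam : ℕ → ℕ} (hpart : IsPartitionOf d ℓ lam) {a : ℕ → ℂ}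
    (ha0 : ∀ i, i < lam 0 → a i ≠ 0)
    (hdist : ∀ i j, i < lam 0 → j < lam 0 → i ≠ j → a i ≠ a j)
    (f : MvPolynomial (Fin d) ℂ)
    (hf : ∀ c : Fin d → ℂ, (∀ g ∈ tanIdeal d ℓ lam a, aeval c g = 0) → aeval c f = 0) :
    f ∈ tanIdeal d ℓ lam a := by
  set I := tanIdeal d ℓ lam a with hI
  set K : Ideal (MvPolynomial (Fin d) ℂ) :=
    Submodule.comap (LinearMap.mulRight (MvPolynomial (Fin d) ℂ) f) I with hK
  have hKm : ∀ g, g ∈ K ↔ g * f ∈ I := fun g => Iff.rfl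
  by_cases hKt : K = ⊤
  · have : (1 : MvPolynomial (Fin d) ℂ) ∈ K := hKt ▸ Submodule.mem_top
    simpa [hKm] using this
  exfalso
  obtain ⟨c, hc⟩ := exists_zero K hKt
  have hcI : ∀ g ∈ I, aeval c g = 0 := fun g hg => hc g ((hKm g).2 (I.mul_mem_right f hg))
  choose u hu0 hu using local_unit hpart ha0 hdist c hcI
  have hprod : ∀ g : MvPolynomial (Fin d) ℂ, (∏ j, u j) * (g - C (aeval c g)) ∈ I := by
    intro g
    induction g using MvPolynomial.induction_on with
    | C x => simp [← MvPolynomial.algebraMap_eq]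
    | add p q hp hq =>
      convert I.add_mem hp hq using 1
      simp only [map_add]; ring
    | mul_X p j hp =>
      have h1 : (∏ j, u j) * (X j - C (c j)) ∈ I := by
        rw [← Finset.mul_prod_erase _ u (Finset.mem_univ j)]
        convert I.mul_mem_left (∏ i ∈ Finset.univ.erase j, u i) (hu j) using 1
        ring
      convert I.add_mem (I.mul_mem_left (X j) hp) (I.mul_mem_left (C (aeval c p)) h1) using 1
      simp only [map_mul, aeval_X]; ring
  have h0 := hprod f
  rw [hf c hcI, C_0, sub_zero] at h0
  have := hc _ ((hKm _).2 h0)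
  rw [map_prod, Finset.prod_eq_zero_iff] at this
  obtain ⟨j, -, hj⟩ := this
  exact hu0 j hj

lemma exists_perm {d : ℕ} (c c' : Fin d → ℂ)
    (h : (Finset.univ.val.map c : Multiset ℂ) = Finset.univ.val.map c') :
    ∃ σ : Equiv.Perm (Fin d), c ∘ σ = c' := by
  classical
  have hx : ∀ x, Nonempty ({i // c' i = x} ≃ {i // c i = x}) := by
    intro x
    rw [← Fintype.card_eq, Fintype.card_subtype, Fintype.card_subtype]
    have := congrArg (Multiset.count x) h
    rw [Multiset.count_map, Multiset.count_map] at this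
    rw [Finset.card_def, Finset.card_def, Finset.filter_val, Finset.filter_val]
    simp only [eq_comm (b := x)]
    exact this.symm
  refine ⟨Equiv.ofFiberEquiv fun x => (hx x).some, ?_⟩
  funext i
  exact Equiv.ofFiberEquiv_map _ i

/-- if the `a_i` are nonzero and pairwise distinct, then every `ℂ`-subspace of
`R_a(λ)` that is stable under multiplication by each `t_i` and under the `S_d`-action is
`0` or everything (irreducibility as a module over the extended affine symmetric group). -/
theorem deformed_TGP_irreducible (d ℓ : ℕ) (lam : ℕ → ℕ) (hpart : IsPartitionOf d ℓ lam)
    (a : ℕ → ℂ) (ha0 : ∀ i, i < lam 0 → a i ≠ 0)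
    (hdist : ∀ i j, i < lam 0 → j < lam 0 → i ≠ j → a i ≠ a j)
    (W : Submodule ℂ (TGPAlg d ℓ lam a))
    (hmul : ∀ w ∈ W, ∀ i : Fin d,
      Ideal.Quotient.mk (tanIdeal d ℓ lam a) (X i) * w ∈ W)
    (hperm : ∀ σ : Equiv.Perm (Fin d),
      ∀ F : TGPAlg d ℓ lam a →ₗ[ℂ] TGPAlg d ℓ lam a,
      (∀ g : MvPolynomial (Fin d) ℂ,
        F (Ideal.Quotient.mk (tanIdeal d ℓ lam a) g) =
          Ideal.Quotient.mk (tanIdeal d ℓ lam a) (rename σ g)) →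
      ∀ w ∈ W, F w ∈ W) :
    W = ⊥ ∨ W = ⊤ := by
  classical
  set I := tanIdeal d ℓ lam a with hI
  have hmulP : ∀ g : MvPolynomial (Fin d) ℂ, ∀ w ∈ W, Ideal.Quotient.mk I g * w ∈ W := by
    intro g
    induction g using MvPolynomial.induction_on with
    | C x =>
      intro w hw
      have : Ideal.Quotient.mk I (C x) * w = x • w := by
        obtain ⟨g, rfl⟩ := Ideal.Quotient.mk_surjective w
        rw [← map_mul, MvPolynomial.C_mul']
        rfl
      rw [this]; exact W.smul_mem x hw
    | add p q hp hq =>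
      intro w hw
      rw [map_add, add_mul]; exact W.add_mem (hp w hw) (hq w hw)
    | mul_X p j hp =>
      intro w hw
      rw [map_mul, mul_assoc]; exact hp _ (hmul w hw j)
  let W' : Ideal (MvPolynomial (Fin d) ℂ) :=
    { carrier := {g | Ideal.Quotient.mk I g ∈ W}
      add_mem' := fun {x y} hx hy => by
        simp only [Set.mem_setOf_eq] at hx hy ⊢
        rw [map_add]; exact W.add_mem hx hy
      zero_mem' := by
        simp only [Set.mem_setOf_eq, map_zero]; exact W.zero_mem
      smul_mem' := fun g x hx => by
        simp only [Set.mem_setOf_eq] at hx ⊢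
        rw [smul_eq_mul, map_mul]; exact hmulP g _ hx }
  have hW' : ∀ g, g ∈ W' ↔ Ideal.Quotient.mk I g ∈ W := fun g => Iff.rfl
  have hIW : I ≤ W' := fun g hg => by
    rw [hW', Ideal.Quotient.eq_zero_iff_mem.2 hg]; exact W.zero_mem
  have hren : ∀ (σ : Equiv.Perm (Fin d)) g, g ∈ W' → rename σ g ∈ W' := by
    intro σ g hg
    let F : TGPAlg d ℓ lam a →ₐ[ℂ] TGPAlg d ℓ lam a :=
      Ideal.quotientMapₐ I (rename σ) (fun f hf => rename_mem σ f hf)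
    exact hperm σ F.toLinearMap (fun g => rfl) _ hg
  by_cases hT : W' = ⊤
  · right
    rw [eq_top_iff]
    rintro w -
    obtain ⟨g, rfl⟩ := Ideal.Quotient.mk_surjective w
    exact (hW' g).1 (hT ▸ Submodule.mem_top)
  · left
    rw [eq_bot_iff]
    intro w hw
    obtain ⟨g, rfl⟩ := Ideal.Quotient.mk_surjective w
    rw [Submodule.mem_bot, Ideal.Quotient.eq_zero_iff_mem]
    obtain ⟨c, hc⟩ := exists_zero W' hT
    apply mem_of_vanish hpart ha0 hdist
    intro c' hc'
    obtain ⟨σ, rfl⟩ := exists_perm c c' (by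
      rw [point_content hpart c (fun f hf => hc f (hIW hf)), point_content hpart c' hc'])
    have := hc _ (hren σ g hw)
    rwa [aeval_rename] at this

end
end

section
/- The deformed Tanisaki ideal ⟨𝒞^a_λ⟩ is already generated by the smaller set of generators g_{n,J,r} where n ranges over 0 ≤ n < ℓ, J ranges over subsets of {1, …, d} with |J| = d − n, and r is restricted to the range d − n − m_λ(n) < r ≤ d − n − m_λ(n) + λ_{n+1}. -/
open MvPolynomial

noncomputable section

/-- Generator attached to an arbitrary list. -/
def genL (d : ℕ) (L : List ℂ) (J : Finset (Fin d)) (r : ℕ) : MvPolynomial (Fin d) ℂ :=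
  ∑ k ∈ Finset.range (r + 1), C ((-1) ^ k * hcomp k L) * elemSym d J (r - k)

lemma hcomp_zero' (L : List ℂ) : hcomp 0 L = 1 := by
  unfold hcomp; rfl

lemma hcomp_cons' (k : ℕ) (x : ℂ) (L : List ℂ) :
    hcomp (k + 1) (x :: L) = x * hcomp k (x :: L) + hcomp (k + 1) L := by
  conv_lhs => unfold hcomp

lemma hcomp_nil' (k : ℕ) : hcomp (k + 1) [] = 0 := by
  unfold hcomp; rfl

lemma genL_cons (d : ℕ) (x : ℂ) (L : List ℂ) (J : Finset (Fin d)) (r : ℕ) :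
    genL d L J (r + 1) = genL d (x :: L) J (r + 1) + C x * genL d (x :: L) J r := by
  unfold genL
  rw [Finset.sum_range_succ' _ (r + 1), Finset.sum_range_succ' _ (r + 1), Finset.mul_sum,
    hcomp_zero', hcomp_zero', add_right_comm, ← Finset.sum_add_distrib]
  congr 1
  refine Finset.sum_congr rfl fun k _ => ?_
  rw [hcomp_cons', Nat.add_sub_add_right]
  simp only [pow_succ, map_mul, map_add, map_neg, map_one]
  ring

lemma elemSym_insert (d : ℕ) (j : Fin d) (J : Finset (Fin d)) (hj : j ∉ J) (r : ℕ) :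
    elemSym d (insert j J) (r + 1) = elemSym d J (r + 1) + X j * elemSym d J r := by
  unfold elemSym
  rw [Finset.powersetCard_succ_insert hj, Finset.sum_union, Finset.sum_image, Finset.mul_sum]
  · congr 1
    refine Finset.sum_congr rfl fun s hs => ?_
    rw [Finset.prod_insert]
    exact fun h => hj ((Finset.mem_powersetCard.1 hs).1 h)
  · intro s hs t ht h
    have h1 : j ∉ s := fun h => hj ((Finset.mem_powersetCard.1 hs).1 h)
    have h2 : j ∉ t := fun h => hj ((Finset.mem_powersetCard.1 ht).1 h)
    rw [← Finset.erase_insert h1, ← Finset.erase_insert h2]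
    exact congrArg (fun u => Finset.erase u j) h
  · rw [Finset.disjoint_left]
    intro s hs ht
    obtain ⟨t, _, rfl⟩ := Finset.mem_image.1 ht
    exact hj ((Finset.mem_powersetCard.1 hs).1 (Finset.mem_insert_self j t))

lemma elemSym_zero' (d : ℕ) (J : Finset (Fin d)) : elemSym d J 0 = 1 := by
  simp [elemSym]

lemma genL_insert (d : ℕ) (L : List ℂ) (j : Fin d) (J : Finset (Fin d)) (hj : j ∉ J) (r : ℕ) :
    genL d L (insert j J) (r + 1) = genL d L J (r + 1) + X j * genL d L J r := by
  unfold genL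
  rw [Finset.sum_range_succ _ (r + 1), Finset.sum_range_succ _ (r + 1), Finset.mul_sum,
    Nat.sub_self, elemSym_zero', elemSym_zero', add_right_comm, ← Finset.sum_add_distrib]
  congr 1
  refine Finset.sum_congr rfl fun k hk => ?_
  have hk' : k ≤ r := Nat.lt_succ_iff.1 (Finset.mem_range.1 hk)
  rw [Nat.succ_sub hk', Nat.succ_eq_add_one, elemSym_insert d j J hj]
  ring

lemma genL_nil (d : ℕ) (J : Finset (Fin d)) (r : ℕ) (h : J.card < r) : genL d [] J r = 0 := by
  unfold genL
  rw [Finset.sum_range_succ', Finset.sum_eq_zero]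
  · simp [elemSym, Finset.powersetCard_eq_empty.2 h]
  · intro k _
    simp [hcomp_nil']

lemma genL_append (d : ℕ) (I : Ideal (MvPolynomial (Fin d) ℂ)) (J : Finset (Fin d)) (L : List ℂ)
    (A : List ℂ) : ∀ N : ℕ, (∀ r, N + A.length < r → genL d L J r ∈ I) →
      (∀ r, N < r → r ≤ N + A.length → genL d (A ++ L) J r ∈ I) →
      ∀ r, N < r → genL d (A ++ L) J r ∈ I := by
  induction A with
  | nil => intro N h1 _ r hr; simpa using h1 r (by simpa using hr)
  | cons x A ih =>
    intro N h1 h2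
    rw [List.length_cons] at h1 h2
    have key := ih (N + 1) (fun r hr => h1 r (by omega)) (by
      intro r hr hr'
      obtain ⟨s, rfl⟩ : ∃ s, r = s + 1 := ⟨r - 1, by omega⟩
      rw [genL_cons d x]
      exact I.add_mem (h2 _ (by omega) (by omega))
        (I.mul_mem_left _ (h2 _ (by omega) (by omega))))
    intro r hr
    induction r, hr using Nat.le_induction with
    | base => exact h2 _ (by omega) (by omega)
    | succ r hr ihr =>
      have h := key (r + 1) (by omega)
      rw [genL_cons d x] at h
      exact (I.add_mem_iff_left (I.mul_mem_left _ ihr)).1 h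

lemma aTuple_step (ℓ : ℕ) (lam : ℕ → ℕ) (a : ℕ → ℂ) (n : ℕ) (hn : n < ℓ) :
    aTuple ℓ lam a n = (List.range (lam n)).map a ++ aTuple ℓ lam a (n + 1) := by
  unfold aTuple
  rw [List.drop_eq_getElem_cons (by simpa using hn)]
  simp

lemma mRem_step (ℓ : ℕ) (lam : ℕ → ℕ) (n : ℕ) (hn : n < ℓ) :
    mRem ℓ lam n = lam n + mRem ℓ lam (n + 1) := by
  unfold mRem
  rw [Finset.sum_eq_sum_Ico_succ_bot hn]

lemma mRem_bound (d ℓ : ℕ) (lam : ℕ → ℕ) (h : IsPartitionOf d ℓ lam) (n : ℕ) (hn : n ≤ ℓ) :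
    n + mRem ℓ lam n ≤ d := by
  obtain ⟨_, _, hpos, _, hs⟩ := h
  have : n ≤ ∑ i ∈ Finset.range n, lam i := by
    calc n = ∑ i ∈ Finset.range n, 1 := by simp
      _ ≤ _ := Finset.sum_le_sum fun i hi => hpos i (by have := Finset.mem_range.1 hi; omega)
  have h2 := Finset.sum_range_add_sum_Ico lam hn
  unfold mRem
  omega

lemma tan_mem (d ℓ : ℕ) (lam : ℕ → ℕ) (hpart : IsPartitionOf d ℓ lam) (a : ℕ → ℂ)
    (I : Ideal (MvPolynomial (Fin d) ℂ))
    (hI : ∀ n J r, n < ℓ → J.card = d - n → d - n - mRem ℓ lam n < r →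
      r ≤ d - n - mRem ℓ lam n + lam n → genL d (aTuple ℓ lam a n) J r ∈ I) (n : ℕ) (hn : n ≤ ℓ) :
    ∀ J : Finset (Fin d), J.card = d - n → ∀ r, d - n - mRem ℓ lam n < r →
      genL d (aTuple ℓ lam a n) J r ∈ I := by
  induction hn using Nat.decreasingInduction with
  | self =>
    intro J hJ r hr
    have : aTuple ℓ lam a ℓ = [] := by
      unfold aTuple
      rw [List.drop_eq_nil_of_le (by simp), List.flatMap_nil]
    have h0 : mRem ℓ lam ℓ = 0 := by simp [mRem]
    rw [this, genL_nil d J r (by omega)]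
    exact I.zero_mem
  | of_succ n hn ih =>
    intro J hJ
    have hs := mRem_step ℓ lam n hn
    have hb := mRem_bound d ℓ lam hpart n hn.le
    have hb' := mRem_bound d ℓ lam hpart (n + 1) hn
    have hI' := hI n J
    rw [aTuple_step ℓ lam a n hn] at hI' ⊢
    refine genL_append d I J _ _ _ ?_ ?_
    · intro r hr
      simp only [List.length_map, List.length_range] at hr
      obtain ⟨j, hj⟩ : J.Nonempty := Finset.card_pos.1 (by omega)
      have hc : (J.erase j).card = d - (n + 1) := by
        rw [Finset.card_erase_of_mem hj]; omega
      obtain ⟨s, rfl⟩ : ∃ s, r = s + 1 := ⟨r - 1, by omega⟩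
      rw [← Finset.insert_erase hj, genL_insert _ _ _ _ (Finset.notMem_erase j J)]
      exact I.add_mem (ih _ hc _ (by omega)) (I.mul_mem_left _ (ih _ hc _ (by omega)))
    · intro r hr hr'
      simp only [List.length_map, List.length_range] at hr'
      exact hI' r hn hJ hr hr'

/-- the deformed Tanisaki ideal is already generated by the generators
`g_{n,J,r}` with `r` in the restricted range
`d − n − m_λ(n) < r ≤ d − n − m_λ(n) + λ_{n+1}`. -/
theorem deformed_TGP_fewer_generators (d ℓ : ℕ) (lam : ℕ → ℕ)
    (hpart : IsPartitionOf d ℓ lam) (a : ℕ → ℂ) :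
    tanIdeal d ℓ lam a =
      Ideal.span {g | ∃ n J r, n < ℓ ∧ J.card = d - n ∧
        d - n - mRem ℓ lam n < r ∧ r ≤ d - n - mRem ℓ lam n + lam n ∧
        g = tanGen d ℓ lam a n J r} := by
  apply le_antisymm
  · refine Ideal.span_le.2 ?_
    rintro g ⟨n, J, r, hn, hJ, hr, _, rfl⟩
    refine tan_mem d ℓ lam hpart a _ ?_ n hn.le J hJ r hr
    intro n J r h1 h2 h3 h4
    exact Ideal.subset_span ⟨n, J, r, h1, h2, h3, h4, rfl⟩
  · refine Ideal.span_mono ?_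
    rintro g ⟨n, J, r, hn, hJ, hr, hr', rfl⟩
    have hs := mRem_step ℓ lam n hn
    have hb := mRem_bound d ℓ lam hpart n hn.le
    exact ⟨n, J, r, hn, hJ, hr, by omega, rfl⟩

end
end
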